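/- arXiv:math/0401056 — 3 statements merged into one kernel-verified Lean document; each statement's English description precedes it below -/
import Mathlib

section
/- Define S(n) = ∑ kℓ, the sum over all quadruples (a,b,k,ℓ) of positive integers with ak + bℓ = n and k < ℓ. Then S(n)/n³ → 5/24 as n → ∞ along prime numbers n (i.e. along the filter atTop restricted to primes). -/
open Filter

/-- All positive solutions of `ak + bl = n`. -/
def solSet (n : ℕ) : Finset ((ℕ × ℕ) × ℕ × ℕ) :=
  ((Finset.Ioc 0 n ×ˢ Finset.Ioc 0 n) ×ˢ (Finset.Ioc 0 n ×ˢ Finset.Ioc 0 n)).filter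
    (fun q => q.1.1 * q.2.1 + q.1.2 * q.2.2 = n)

lemma mem_solSet (n a b k l : ℕ) : ((a, b), (k, l)) ∈ solSet n ↔
    0 < a ∧ 0 < b ∧ 0 < k ∧ 0 < l ∧ a * k + b * l = n := by
  simp only [solSet, Finset.mem_filter, Finset.mem_product, Finset.mem_Ioc]
  constructor
  · rintro ⟨⟨⟨⟨h1, _⟩, h2, _⟩, ⟨h3, _⟩, h4, _⟩, h5⟩
    exact ⟨h1, h2, h3, h4, h5⟩
  · rintro ⟨h1, h2, h3, h4, h5⟩
    have e1 := Nat.le_mul_of_pos_right a h3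
    have e2 := Nat.le_mul_of_pos_left k h1
    have e3 := Nat.le_mul_of_pos_right b h4
    have e4 := Nat.le_mul_of_pos_left l h2
    exact ⟨⟨⟨⟨h1, by omega⟩, h2, by omega⟩, ⟨h3, by omega⟩, h4, by omega⟩, h5⟩

lemma split_wt (n : ℕ) (g : ℕ → ℕ → ℤ) :
    ∑ q ∈ solSet n, g q.2.1 q.2.2 =
      ∑ q ∈ (solSet n).filter (fun q => q.2.1 < q.2.2), (g q.2.1 q.2.2 + g q.2.2 q.2.1) +
      ∑ q ∈ (solSet n).filter (fun q => q.2.1 = q.2.2), g q.2.1 q.2.2 := by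
  have h : ∑ q ∈ (solSet n).filter (fun q => q.2.1 < q.2.2), g q.2.2 q.2.1 =
      ∑ q ∈ (solSet n).filter (fun q => q.2.2 < q.2.1), g q.2.1 q.2.2 := by
    refine Finset.sum_nbij' (fun q => (q.1.swap, q.2.swap)) (fun q => (q.1.swap, q.2.swap))
      ?_ ?_ ?_ ?_ ?_
    · rintro ⟨⟨a, b⟩, k, l⟩
      simp only [Finset.mem_filter, Prod.swap, mem_solSet]
      rintro ⟨⟨h1, h2, h3, h4, h5⟩, h6⟩
      exact ⟨⟨h2, h1, h4, h3, by omega⟩, h6⟩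
    · rintro ⟨⟨a, b⟩, k, l⟩
      simp only [Finset.mem_filter, Prod.swap, mem_solSet]
      rintro ⟨⟨h1, h2, h3, h4, h5⟩, h6⟩
      exact ⟨⟨h2, h1, h4, h3, by omega⟩, h6⟩
    · simp
    · simp
    · simp
  rw [Finset.sum_add_distrib, h]
  simp only [Finset.sum_filter, ← Finset.sum_add_distrib]
  refine Finset.sum_congr rfl fun q _ => ?_
  split_ifs <;> omega

lemma split_ht (n : ℕ) (g : ℕ → ℕ → ℤ) :
    ∑ q ∈ solSet n, g q.2.1 q.2.2 =
      ∑ q ∈ (solSet n).filter (fun q => q.1.2 < q.1.1), (g q.2.1 q.2.2 + g q.2.2 q.2.1) +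
      ∑ q ∈ (solSet n).filter (fun q => q.1.1 = q.1.2), g q.2.1 q.2.2 := by
  have h : ∑ q ∈ (solSet n).filter (fun q => q.1.2 < q.1.1), g q.2.2 q.2.1 =
      ∑ q ∈ (solSet n).filter (fun q => q.1.1 < q.1.2), g q.2.1 q.2.2 := by
    refine Finset.sum_nbij' (fun q => (q.1.swap, q.2.swap)) (fun q => (q.1.swap, q.2.swap))
      ?_ ?_ ?_ ?_ ?_
    · rintro ⟨⟨a, b⟩, k, l⟩
      simp only [Finset.mem_filter, Prod.swap, mem_solSet]
      rintro ⟨⟨h1, h2, h3, h4, h5⟩, h6⟩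
      exact ⟨⟨h2, h1, h4, h3, by omega⟩, h6⟩
    · rintro ⟨⟨a, b⟩, k, l⟩
      simp only [Finset.mem_filter, Prod.swap, mem_solSet]
      rintro ⟨⟨h1, h2, h3, h4, h5⟩, h6⟩
      exact ⟨⟨h2, h1, h4, h3, by omega⟩, h6⟩
    · simp
    · simp
    · simp
  rw [Finset.sum_add_distrib, h]
  simp only [Finset.sum_filter, ← Finset.sum_add_distrib]
  refine Finset.sum_congr rfl fun q _ => ?_
  split_ifs <;> omega

lemma shear (n : ℕ) (g : ℕ → ℕ → ℤ) :
    ∑ q ∈ (solSet n).filter (fun q => q.2.1 < q.2.2), g q.2.1 q.2.2 =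
    ∑ q ∈ (solSet n).filter (fun q => q.1.2 < q.1.1), g q.2.1 (q.2.1 + q.2.2) := by
  refine Finset.sum_nbij' (fun q => ((q.1.1 + q.1.2, q.1.2), (q.2.1, q.2.2 - q.2.1)))
    (fun q => ((q.1.1 - q.1.2, q.1.2), (q.2.1, q.2.1 + q.2.2))) ?_ ?_ ?_ ?_ ?_
  · rintro ⟨⟨a, b⟩, k, l⟩
    simp only [Finset.mem_filter, mem_solSet]
    rintro ⟨⟨h1, h2, h3, h4, h5⟩, h6⟩
    obtain ⟨c, rfl⟩ := Nat.exists_eq_add_of_lt h6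
    refine ⟨⟨by omega, h2, h3, by omega, ?_⟩, by omega⟩
    rw [show k + c + 1 - k = c + 1 by omega, ← h5]; ring
  · rintro ⟨⟨a, b⟩, k, l⟩
    simp only [Finset.mem_filter, mem_solSet]
    rintro ⟨⟨h1, h2, h3, h4, h5⟩, h6⟩
    obtain ⟨c, rfl⟩ := Nat.exists_eq_add_of_lt h6
    refine ⟨⟨by omega, h2, h3, by omega, ?_⟩, by omega⟩
    rw [show b + c + 1 - b = c + 1 by omega, ← h5]; ring
  · rintro ⟨⟨a, b⟩, k, l⟩
    simp only [Finset.mem_filter, mem_solSet, Prod.mk.injEq]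
    rintro ⟨-, h6⟩
    refine ⟨⟨?_, ?_⟩, ?_, ?_⟩ <;> first | trivial | omega
  · rintro ⟨⟨a, b⟩, k, l⟩
    simp only [Finset.mem_filter, mem_solSet, Prod.mk.injEq]
    rintro ⟨-, h6⟩
    refine ⟨⟨?_, ?_⟩, ?_, ?_⟩ <;> first | trivial | omega
  · rintro ⟨⟨a, b⟩, k, l⟩
    simp only [Finset.mem_filter]
    rintro ⟨-, h6⟩
    rw [show k + (l - k) = l by omega]

lemma main_identity (n : ℕ) :
    4 * ∑ q ∈ (solSet n).filter (fun q => q.2.1 < q.2.2), (q.2.1 * q.2.2 : ℤ) +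
    3 * ∑ q ∈ (solSet n).filter (fun q => q.2.1 = q.2.2), (q.2.1 : ℤ) ^ 2 =
    2 * ∑ q ∈ (solSet n).filter (fun q => q.1.1 = q.1.2), (q.2.1 : ℤ) ^ 2 +
    ∑ q ∈ (solSet n).filter (fun q => q.1.1 = q.1.2), (q.2.1 * q.2.2 : ℤ) := by
  have a1 := split_wt n (fun k _ => (k : ℤ) ^ 2)
  have a2 := split_ht n (fun k _ => (k : ℤ) ^ 2)
  have a3 := split_wt n (fun k l => (k : ℤ) * l)
  have a4 := split_ht n (fun k l => (k : ℤ) * l)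
  have b1 := shear n (fun k _ => (k : ℤ) ^ 2)
  have b2 := shear n (fun k l => (l : ℤ) ^ 2)
  have b3 := shear n (fun k l => (k : ℤ) * l)
  have e : ∑ q ∈ (solSet n).filter (fun q => q.2.1 = q.2.2), (q.2.1 * q.2.2 : ℤ) =
      ∑ q ∈ (solSet n).filter (fun q => q.2.1 = q.2.2), (q.2.1 : ℤ) ^ 2 := by
    refine Finset.sum_congr rfl fun q hq => ?_
    rw [← (Finset.mem_filter.1 hq).2, sq]
  have c (s : Finset ((ℕ × ℕ) × ℕ × ℕ)) :
      ∑ q ∈ s, (q.2.2 * q.2.1 : ℤ) = ∑ q ∈ s, (q.2.1 * q.2.2 : ℤ) :=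
    Finset.sum_congr rfl fun q _ => mul_comm _ _
  simp only [Nat.cast_add, add_sq, mul_add, mul_assoc, ← sq, Finset.sum_add_distrib,
    ← Finset.mul_sum, c, e] at a1 a2 a3 a4 b1 b2 b3
  linarith

lemma diag_wt (n : ℕ) (hn : n.Prime) :
    ∑ q ∈ (solSet n).filter (fun q => q.2.1 = q.2.2), (q.2.1 : ℤ) ^ 2 = (n : ℤ) - 1 := by
  have : ∑ q ∈ (solSet n).filter (fun q => q.2.1 = q.2.2), (q.2.1 : ℤ) ^ 2 =
      ∑ i ∈ Finset.range (n - 1), (1 : ℤ) := by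
    symm
    refine Finset.sum_nbij' (fun i => ((i + 1, n - 1 - i), (1, 1))) (fun q => q.1.1 - 1)
      ?_ ?_ ?_ ?_ ?_
    · intro i hi
      simp only [Finset.mem_range] at hi
      simp only [Finset.mem_filter, mem_solSet, one_mul, mul_one, and_true]
      omega
    · rintro ⟨⟨a, b⟩, k, l⟩
      simp only [Finset.mem_filter, mem_solSet, Finset.mem_range]
      rintro ⟨⟨h1, h2, h3, h4, h5⟩, rfl⟩
      have := Nat.le_mul_of_pos_right a h3
      have := Nat.le_mul_of_pos_right b h3
      omega
    · intro i hi
      simp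
    · rintro ⟨⟨a, b⟩, k, l⟩
      simp only [Finset.mem_filter, mem_solSet, Prod.mk.injEq]
      rintro ⟨⟨h1, h2, h3, h4, h5⟩, rfl⟩
      have hk : k = 1 := by
        rcases (Nat.dvd_prime hn).1 (⟨a + b, by rw [← h5]; ring⟩ : k ∣ n) with h | h
        · exact h
        · subst h
          nlinarith
      subst hk
      omega
    · intro i hi
      simp
  rw [this]
  have := hn.one_lt
  simp
  omega

lemma diag_ht (n : ℕ) (hn : n.Prime) (g : ℕ → ℕ → ℤ) :
    ∑ q ∈ (solSet n).filter (fun q => q.1.1 = q.1.2), g q.2.1 q.2.2 =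
    ∑ i ∈ Finset.range (n - 1), g (i + 1) (n - 1 - i) := by
  symm
  refine Finset.sum_nbij' (fun i => ((1, 1), (i + 1, n - 1 - i))) (fun q => q.2.1 - 1)
    ?_ ?_ ?_ ?_ ?_
  · intro i hi
    simp only [Finset.mem_range] at hi
    simp only [Finset.mem_filter, mem_solSet, one_mul, mul_one, and_true]
    omega
  · rintro ⟨⟨a, b⟩, k, l⟩
    simp only [Finset.mem_filter, mem_solSet, Finset.mem_range]
    rintro ⟨⟨h1, h2, h3, h4, h5⟩, rfl⟩
    have := Nat.le_mul_of_pos_left k h1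
    have := Nat.le_mul_of_pos_left l h1
    omega
  · intro i hi
    simp
  · rintro ⟨⟨a, b⟩, k, l⟩
    simp only [Finset.mem_filter, mem_solSet, Prod.mk.injEq]
    rintro ⟨⟨h1, h2, h3, h4, h5⟩, rfl⟩
    have hk : a = 1 := by
      rcases (Nat.dvd_prime hn).1 (⟨k + l, by rw [← h5]; ring⟩ : a ∣ n) with h | h
      · exact h
      · subst h
        nlinarith
    subst hk
    omega
  · intro i hi
    simp

lemma sum_sq_aux (m : ℕ) : 6 * ∑ i ∈ Finset.range m, ((i + 1 : ℕ) : ℤ) ^ 2 =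
    m * (m + 1) * (2 * m + 1) := by
  induction m with
  | zero => simp
  | succ k ih => rw [Finset.sum_range_succ, mul_add, ih]; push_cast; ring

lemma sum_id_aux (m : ℕ) : 2 * ∑ i ∈ Finset.range m, ((i + 1 : ℕ) : ℤ) =
    m * (m + 1) := by
  induction m with
  | zero => simp
  | succ k ih => rw [Finset.sum_range_succ, mul_add, ih]; push_cast; ring

lemma closed_form (n : ℕ) (hn : n.Prime) :
    24 * ∑ q ∈ (solSet n).filter (fun q => q.2.1 < q.2.2), (q.2.1 * q.2.2 : ℤ) =
    ((n : ℤ) - 1) * (5 * n ^ 2 - n - 18) := by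
  have h := main_identity n
  rw [diag_wt n hn, diag_ht n hn (fun k _ => (k : ℤ) ^ 2),
    diag_ht n hn (fun k l => (k : ℤ) * l)] at h
  have hp := hn.one_lt
  have s2 := sum_sq_aux (n - 1)
  have s1 := sum_id_aux (n - 1)
  have f : ∑ i ∈ Finset.range (n - 1), ((i + 1 : ℕ) : ℤ) * ((n - 1 - i : ℕ) : ℤ) =
      n * ∑ i ∈ Finset.range (n - 1), ((i + 1 : ℕ) : ℤ) -
      ∑ i ∈ Finset.range (n - 1), ((i + 1 : ℕ) : ℤ) ^ 2 := by
    rw [Finset.mul_sum, ← Finset.sum_sub_distrib]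
    refine Finset.sum_congr rfl fun i hi => ?_
    have := Finset.mem_range.1 hi
    rw [show ((n - 1 - i : ℕ) : ℤ) = n - (i + 1 : ℕ) by omega]
    ring
  rw [f] at h
  rw [show ((n - 1 : ℕ) : ℤ) = n - 1 by omega] at s1 s2
  linear_combination 6 * h + s2 + 3 * n * s1

/-- `S(n) = ∑_{a,b,k,ℓ ≥ 1, ak + bℓ = n, k < ℓ} kℓ` satisfies
`S(n)/n³ → 5/24` as `n → ∞` along prime numbers. -/
theorem two_cylinder_surface_count_asymptotics :
    Tendsto
      (fun n : ℕ =>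
        ((∑ q ∈ ((Finset.Ioc 0 n ×ˢ Finset.Ioc 0 n) ×ˢ
              (Finset.Ioc 0 n ×ˢ Finset.Ioc 0 n)).filter
            (fun q : (ℕ × ℕ) × ℕ × ℕ =>
              q.1.1 * q.2.1 + q.1.2 * q.2.2 = n ∧ q.2.1 < q.2.2),
            q.2.1 * q.2.2 : ℕ) : ℝ) / (n : ℝ) ^ 3)
      (atTop ⊓ Filter.principal {n : ℕ | n.Prime}) (nhds (5 / 24)) := by
  have hlim : Tendsto (fun n : ℕ => (1 - (n : ℝ)⁻¹) * (5 - (n : ℝ)⁻¹ - 18 * (n : ℝ)⁻¹ ^ 2) / 24)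
      atTop (nhds (5 / 24)) := by
    have h0 : Tendsto (fun n : ℕ => (n : ℝ)⁻¹) atTop (nhds 0) := tendsto_inv_atTop_nhds_zero_nat
    have hc : Continuous (fun x : ℝ => (1 - x) * (5 - x - 18 * x ^ 2) / 24) := by fun_prop
    have := (hc.tendsto 0).comp h0
    simpa [Function.comp_def] using this
  refine (hlim.mono_left inf_le_left).congr' ?_
  have hev : ∀ᶠ n in atTop ⊓ Filter.principal {n : ℕ | n.Prime}, n.Prime :=
    mem_inf_of_right (mem_principal_self _)
  filter_upwards [hev] with n hn
  have h := closed_form n hn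
  rw [solSet, Finset.filter_filter] at h
  have hr : (24 : ℝ) * ((∑ q ∈ ((Finset.Ioc 0 n ×ˢ Finset.Ioc 0 n) ×ˢ
              (Finset.Ioc 0 n ×ˢ Finset.Ioc 0 n)).filter
            (fun q : (ℕ × ℕ) × ℕ × ℕ =>
              q.1.1 * q.2.1 + q.1.2 * q.2.2 = n ∧ q.2.1 < q.2.2),
            q.2.1 * q.2.2 : ℕ) : ℝ) = ((n : ℝ) - 1) * (5 * n ^ 2 - n - 18) := by
    exact_mod_cast h
  have hn0 : (n : ℝ) ≠ 0 := by exact_mod_cast hn.ne_zero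
  rw [eq_div_iff (pow_ne_zero 3 hn0)]
  have e : (1 - (n : ℝ)⁻¹) * (5 - (n : ℝ)⁻¹ - 18 * (n : ℝ)⁻¹ ^ 2) / 24 * (n : ℝ) ^ 3 =
      ((n : ℝ) - 1) * (5 * n ^ 2 - n - 18) / 24 := by
    field_simp
  rw [e, ← hr]
  ring
end

section
/- Define S_ow(n) = ∑ kℓ, the sum over all quadruples (a,b,k,ℓ) of positive integers with k and ℓ both odd, gcd(a,b) = 1, ak + bℓ = n and k < ℓ. Then S_ow(n)/n³ → 1/24 as n → ∞ along prime numbers n. -/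
open Filter

namespace TwoCyl

/-- positive solutions of `a k + b l = n` -/
def G (n : ℕ) : Finset ((ℕ × ℕ) × ℕ × ℕ) :=
  ((Finset.Ioc 0 n ×ˢ Finset.Ioc 0 n) ×ˢ (Finset.Ioc 0 n ×ˢ Finset.Ioc 0 n)).filter
    (fun q => q.1.1 * q.2.1 + q.1.2 * q.2.2 = n)

lemma mem_G {n a b k l : ℕ} : ((a, b), (k, l)) ∈ G n ↔
    0 < a ∧ 0 < b ∧ 0 < k ∧ 0 < l ∧ a * k + b * l = n := by
  simp only [G, Finset.mem_filter, Finset.mem_product, Finset.mem_Ioc]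
  constructor
  · tauto
  · rintro ⟨ha, hb, hk, hl, h⟩
    have h1 : a ≤ a * k := Nat.le_mul_of_pos_right _ hk
    have h2 : k ≤ a * k := Nat.le_mul_of_pos_left _ ha
    have h3 : b ≤ b * l := Nat.le_mul_of_pos_right _ hl
    have h4 : l ≤ b * l := Nat.le_mul_of_pos_left _ hb
    refine ⟨⟨⟨⟨ha, ?_⟩, ⟨hb, ?_⟩⟩, ⟨⟨hk, ?_⟩, ⟨hl, ?_⟩⟩⟩, h⟩ <;> omega

/-- solutions with both widths odd -/
def O (n : ℕ) := (G n).filter (fun q => Odd q.2.1 ∧ Odd q.2.2)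
/-- solutions with first width odd, second even -/
def E (n : ℕ) := (G n).filter (fun q => Odd q.2.1 ∧ Even q.2.2)

lemma mem_O {n a b k l : ℕ} : ((a, b), (k, l)) ∈ O n ↔
    (0 < a ∧ 0 < b ∧ 0 < k ∧ 0 < l ∧ a * k + b * l = n) ∧ Odd k ∧ Odd l := by
  simp only [O, Finset.mem_filter, mem_G]

lemma mem_E {n a b k l : ℕ} : ((a, b), (k, l)) ∈ E n ↔
    (0 < a ∧ 0 < b ∧ 0 < k ∧ 0 < l ∧ a * k + b * l = n) ∧ Odd k ∧ Even l := by
  simp only [E, Finset.mem_filter, mem_G]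

lemma split3 {α : Type*} (s : Finset α) (u v : α → ℕ) (f : α → ℤ) :
    ∑ q ∈ s, f q = ∑ q ∈ s.filter (fun q => u q < v q), f q
      + ∑ q ∈ s.filter (fun q => u q = v q), f q
      + ∑ q ∈ s.filter (fun q => v q < u q), f q := by
  simp only [Finset.sum_filter, ← Finset.sum_add_distrib]
  refine Finset.sum_congr rfl fun q _ => ?_
  rcases lt_trichotomy (u q) (v q) with h | h | h
  · simp [h, h.ne, h.not_gt]
  · simp [h]
  · simp [h, h.ne', h.not_gt]

lemma swap_sum (n : ℕ) (P P' : (ℕ × ℕ) × ℕ × ℕ → Prop) [DecidablePred P] [DecidablePred P']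
    (f : (ℕ × ℕ) × ℕ × ℕ → ℤ)
    (hP : ∀ a b k l, P' ((b, a), (l, k)) ↔ P ((a, b), (k, l)))
    (hf : ∀ a b k l, f ((b, a), (l, k)) = f ((a, b), (k, l))) :
    ∑ q ∈ (O n).filter P, f q = ∑ q ∈ (O n).filter P', f q := by
  refine Finset.sum_nbij' (fun q => ((q.1.2, q.1.1), (q.2.2, q.2.1)))
    (fun q => ((q.1.2, q.1.1), (q.2.2, q.2.1))) ?_ ?_ ?_ ?_ ?_
  · rintro ⟨⟨a, b⟩, k, l⟩ h
    simp only [Finset.mem_filter, mem_O, hP] at h ⊢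
    obtain ⟨⟨⟨h1, h2, h3, h4, h5⟩, h6, h7⟩, h8⟩ := h
    exact ⟨⟨⟨h2, h1, h4, h3, by omega⟩, h7, h6⟩, h8⟩
  · rintro ⟨⟨a, b⟩, k, l⟩ h
    simp only [Finset.mem_filter, mem_O, ← hP] at h ⊢
    obtain ⟨⟨⟨h1, h2, h3, h4, h5⟩, h6, h7⟩, h8⟩ := h
    exact ⟨⟨⟨h2, h1, h4, h3, by omega⟩, h7, h6⟩, h8⟩
  · rintro ⟨⟨a, b⟩, k, l⟩ h; rfl
  · rintro ⟨⟨a, b⟩, k, l⟩ h; rfl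
  · rintro ⟨⟨a, b⟩, k, l⟩ h; exact (hf _ _ _ _).symm

lemma step1 (n : ℕ) : ∑ q ∈ (O n).filter (fun q => q.1.2 < q.1.1), ((q.2.1 : ℤ) + q.2.2) ^ 2
    = ∑ q ∈ (E n).filter (fun q => q.2.1 < q.2.2), (q.2.2 : ℤ) ^ 2 := by
  refine Finset.sum_nbij' (fun q => ((q.1.1 - q.1.2, q.1.2), (q.2.1, q.2.1 + q.2.2)))
    (fun q => ((q.1.1 + q.1.2, q.1.2), (q.2.1, q.2.2 - q.2.1))) ?_ ?_ ?_ ?_ ?_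
  · rintro ⟨⟨a, b⟩, k, l⟩ h
    simp only [Finset.mem_filter, mem_O, mem_E] at h ⊢
    obtain ⟨⟨⟨h1, h2, h3, h4, h5⟩, h6, h7⟩, h8⟩ := h
    obtain ⟨c, rfl⟩ := Nat.exists_eq_add_of_lt h8
    refine ⟨⟨⟨by omega, h2, h3, by omega, ?_⟩, h6, h6.add_odd h7⟩, by omega⟩
    rw [show b + c + 1 - b = c + 1 by omega]
    rw [← h5]; ring
  · rintro ⟨⟨a, b⟩, k, l⟩ h
    simp only [Finset.mem_filter, mem_O, mem_E] at h ⊢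
    obtain ⟨⟨⟨h1, h2, h3, h4, h5⟩, h6, h7⟩, h8⟩ := h
    obtain ⟨c, rfl⟩ := Nat.exists_eq_add_of_lt h8
    rw [show k + c + 1 - k = c + 1 by omega]
    refine ⟨⟨⟨by omega, h2, h3, by omega, ?_⟩, h6, ?_⟩, by omega⟩
    · rw [← h5]; ring
    · rw [Nat.odd_iff] at *; rw [Nat.even_iff] at h7; omega
  · rintro ⟨⟨a, b⟩, k, l⟩ h
    simp only [Finset.mem_filter, mem_O] at h
    ext <;> simp; omega
  · rintro ⟨⟨a, b⟩, k, l⟩ h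
    simp only [Finset.mem_filter, mem_E] at h
    ext <;> simp; omega
  · rintro ⟨⟨a, b⟩, k, l⟩ h
    simp

lemma step3 (n : ℕ) : ∑ q ∈ (O n).filter (fun q => q.2.2 < q.2.1), ((q.2.1 : ℤ) - q.2.2) ^ 2
    = ∑ q ∈ (E n).filter (fun q => q.1.2 < q.1.1), (q.2.2 : ℤ) ^ 2 := by
  refine Finset.sum_nbij' (fun q => ((q.1.1 + q.1.2, q.1.1), (q.2.2, q.2.1 - q.2.2)))
    (fun q => ((q.1.2, q.1.1 - q.1.2), (q.2.2 + q.2.1, q.2.1))) ?_ ?_ ?_ ?_ ?_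
  · rintro ⟨⟨a, b⟩, k, l⟩ h
    simp only [Finset.mem_filter, mem_O, mem_E] at h ⊢
    obtain ⟨⟨⟨h1, h2, h3, h4, h5⟩, h6, h7⟩, h8⟩ := h
    obtain ⟨c, rfl⟩ := Nat.exists_eq_add_of_lt h8
    rw [show l + c + 1 - l = c + 1 by omega]
    refine ⟨⟨⟨by omega, h1, h4, by omega, ?_⟩, h7, ?_⟩, by omega⟩
    · rw [← h5]; ring
    · rw [Nat.odd_iff] at *; rw [Nat.even_iff]; omega
  · rintro ⟨⟨a, b⟩, k, l⟩ h
    simp only [Finset.mem_filter, mem_O, mem_E] at h ⊢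
    obtain ⟨⟨⟨h1, h2, h3, h4, h5⟩, h6, h7⟩, h8⟩ := h
    obtain ⟨c, rfl⟩ := Nat.exists_eq_add_of_lt h8
    rw [show b + c + 1 - b = c + 1 by omega]
    refine ⟨⟨⟨by omega, by omega, by omega, by omega, ?_⟩, h7.add_odd h6, h6⟩, by omega⟩
    rw [← h5]; ring
  · rintro ⟨⟨a, b⟩, k, l⟩ h
    simp only [Finset.mem_filter, mem_O] at h
    ext <;> simp; omega
  · rintro ⟨⟨a, b⟩, k, l⟩ h
    simp only [Finset.mem_filter, mem_E] at h
    ext <;> simp; omega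
  · rintro ⟨⟨a, b⟩, k, l⟩ h
    simp only [Finset.mem_filter, mem_O] at h
    have := h.2.le
    push_cast [this]; ring

lemma step5 (n : ℕ) : ∑ q ∈ (E n).filter (fun q => q.1.1 < q.1.2), (q.2.2 : ℤ) ^ 2
    = ∑ q ∈ (E n).filter (fun q => q.2.2 < q.2.1), (q.2.2 : ℤ) ^ 2 := by
  refine Finset.sum_nbij' (fun q => ((q.1.1, q.1.2 - q.1.1), (q.2.1 + q.2.2, q.2.2)))
    (fun q => ((q.1.1, q.1.2 + q.1.1), (q.2.1 - q.2.2, q.2.2))) ?_ ?_ ?_ ?_ ?_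
  · rintro ⟨⟨a, b⟩, k, l⟩ h
    simp only [Finset.mem_filter, mem_E] at h ⊢
    obtain ⟨⟨⟨h1, h2, h3, h4, h5⟩, h6, h7⟩, h8⟩ := h
    obtain ⟨c, rfl⟩ := Nat.exists_eq_add_of_lt h8
    rw [show a + c + 1 - a = c + 1 by omega]
    refine ⟨⟨⟨by omega, by omega, by omega, by omega, ?_⟩, h6.add_even h7, h7⟩, by omega⟩
    rw [← h5]; ring
  · rintro ⟨⟨a, b⟩, k, l⟩ h
    simp only [Finset.mem_filter, mem_E] at h ⊢
    obtain ⟨⟨⟨h1, h2, h3, h4, h5⟩, h6, h7⟩, h8⟩ := h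
    obtain ⟨c, rfl⟩ := Nat.exists_eq_add_of_lt h8
    rw [show l + c + 1 - l = c + 1 by omega]
    refine ⟨⟨⟨by omega, by omega, by omega, by omega, ?_⟩, ?_, h7⟩, by omega⟩
    · rw [← h5]; ring
    · rw [Nat.odd_iff] at *; rw [Nat.even_iff] at h7; omega
  · rintro ⟨⟨a, b⟩, k, l⟩ h
    simp only [Finset.mem_filter, mem_E] at h
    ext <;> simp; omega
  · rintro ⟨⟨a, b⟩, k, l⟩ h
    simp only [Finset.mem_filter, mem_E] at h
    ext <;> simp; omega
  · rintro ⟨⟨a, b⟩, k, l⟩ h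
    rfl

lemma sum_even_sq (N : ℕ) : 3 * ∑ j ∈ Finset.range N, ((2 * (j + 1) : ℕ) : ℤ) ^ 2
    = 2 * N * (N + 1) * (2 * N + 1) := by
  induction N with
  | zero => simp
  | succ N ih => rw [Finset.sum_range_succ, mul_add, ih]; push_cast; ring

lemma step6 (n N : ℕ) (hn : n.Prime) (hN : n = 2 * N + 1) :
    ∑ q ∈ (E n).filter (fun q => q.1.1 = q.1.2), (q.2.2 : ℤ) ^ 2
    = ∑ j ∈ Finset.range N, ((2 * (j + 1) : ℕ) : ℤ) ^ 2 := by
  have key : ∀ a k l, 0 < k → 0 < l → a * k + a * l = n → a = 1 := by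
    intro a k l hk hl h
    rw [← mul_add] at h
    rcases (Nat.prime_mul_iff.mp (h ▸ hn)) with ⟨_, h'⟩ | ⟨_, h'⟩
    · omega
    · exact h'
  refine Finset.sum_nbij' (fun q => q.2.2 / 2 - 1)
    (fun j => ((1, 1), (n - 2 * (j + 1), 2 * (j + 1)))) ?_ ?_ ?_ ?_ ?_
  · rintro ⟨⟨a, b⟩, k, l⟩ h
    simp only [Finset.mem_filter, mem_E, Finset.mem_range] at h ⊢
    obtain ⟨⟨⟨h1, h2, h3, h4, h5⟩, h6, h7⟩, h8⟩ := h
    subst h8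
    have := key a k l h3 h4 h5
    subst this
    rw [Nat.odd_iff] at *; rw [Nat.even_iff] at h7; omega
  · intro j h
    simp only [Finset.mem_filter, mem_E, Finset.mem_range] at h ⊢
    rw [Nat.odd_iff, Nat.even_iff]
    refine ⟨⟨⟨by omega, by omega, by omega, by omega, by omega⟩, by omega, by omega⟩, trivial⟩
  · rintro ⟨⟨a, b⟩, k, l⟩ h
    simp only [Finset.mem_filter, mem_E] at h
    obtain ⟨⟨⟨h1, h2, h3, h4, h5⟩, h6, h7⟩, h8⟩ := h
    subst h8
    have := key a k l h3 h4 h5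
    subst this
    rw [Nat.even_iff] at h7
    ext <;> simp <;> omega
  · intro j h
    simp
  · rintro ⟨⟨a, b⟩, k, l⟩ h
    simp only [Finset.mem_filter, mem_E] at h
    obtain ⟨⟨⟨h1, h2, h3, h4, h5⟩, h6, h7⟩, h8⟩ := h
    rw [Nat.even_iff] at h7
    have : 2 * (l / 2 - 1 + 1) = l := by omega
    simp only [this]

lemma diag (n : ℕ) (hn : n.Prime) (h2 : 2 < n) :
    ∑ q ∈ (O n).filter (fun q => q.2.1 = q.2.2), ((q.2.1 : ℤ) * q.2.2) = n - 1 := by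
  have key : ∀ a b k, 0 < a → 0 < b → a * k + b * k = n → k = 1 := by
    intro a b k hk hl h
    rw [← add_mul] at h
    rcases (Nat.prime_mul_iff.mp (h ▸ hn)) with ⟨_, h'⟩ | ⟨_, h'⟩
    · exact h'
    · omega
  have : ∑ q ∈ (O n).filter (fun q => q.2.1 = q.2.2), ((q.2.1 : ℤ) * q.2.2)
      = ∑ j ∈ Finset.range (n - 1), (1 : ℤ) := by
    refine Finset.sum_nbij' (fun q => q.1.1 - 1)
      (fun j => ((j + 1, n - 1 - j), (1, 1))) ?_ ?_ ?_ ?_ ?_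
    · rintro ⟨⟨a, b⟩, k, l⟩ h
      simp only [Finset.mem_filter, mem_O, Finset.mem_range] at h ⊢
      obtain ⟨⟨⟨h1, h2, h3, h4, h5⟩, h6, h7⟩, h8⟩ := h
      subst h8
      have := key a b k h1 h2 h5
      subst this
      omega
    · intro j h
      simp only [Finset.mem_filter, mem_O, Finset.mem_range] at h ⊢
      refine ⟨⟨by omega, by decide, by decide⟩, trivial⟩
    · rintro ⟨⟨a, b⟩, k, l⟩ h
      simp only [Finset.mem_filter, mem_O] at h
      obtain ⟨⟨⟨h1, h2, h3, h4, h5⟩, h6, h7⟩, h8⟩ := h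
      subst h8
      have := key a b k h1 h2 h5
      subst this
      ext <;> simp <;> omega
    · intro j h
      simp
    · rintro ⟨⟨a, b⟩, k, l⟩ h
      simp only [Finset.mem_filter, mem_O] at h
      obtain ⟨⟨⟨h1, h2, h3, h4, h5⟩, h6, h7⟩, h8⟩ := h
      subst h8
      have := key a b k h1 h2 h5
      subst this
      simp
  rw [this]
  simp
  omega

lemma total (n N : ℕ) (hn : n.Prime) (hN : n = 2 * N + 1) :
    12 * ∑ q ∈ O n, ((q.2.1 : ℤ) * q.2.2) = (n : ℤ) ^ 3 - n := by
  have hd : 4 * ∑ q ∈ O n, ((q.2.1 : ℤ) * q.2.2)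
      = ∑ q ∈ O n, ((q.2.1 : ℤ) + q.2.2) ^ 2 - ∑ q ∈ O n, ((q.2.1 : ℤ) - q.2.2) ^ 2 := by
    rw [← Finset.sum_sub_distrib, Finset.mul_sum]
    exact Finset.sum_congr rfl fun q _ => by ring
  have e1 := split3 (O n) (fun q => q.1.1) (fun q => q.1.2)
    (fun q => ((q.2.1 : ℤ) + q.2.2) ^ 2)
  have e2 := split3 (O n) (fun q => q.2.1) (fun q => q.2.2)
    (fun q => ((q.2.1 : ℤ) - q.2.2) ^ 2)
  have e3 := split3 (E n) (fun q => q.1.1) (fun q => q.1.2) (fun q => (q.2.2 : ℤ) ^ 2)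
  have e4 := split3 (E n) (fun q => q.2.1) (fun q => q.2.2) (fun q => (q.2.2 : ℤ) ^ 2)
  have s1 := swap_sum n (fun q => q.1.1 < q.1.2) (fun q => q.1.2 < q.1.1)
    (fun q => ((q.2.1 : ℤ) + q.2.2) ^ 2) (by simp) (by intros; ring)
  have s2 := swap_sum n (fun q => q.2.1 < q.2.2) (fun q => q.2.2 < q.2.1)
    (fun q => ((q.2.1 : ℤ) - q.2.2) ^ 2) (by simp) (by intros; ring)
  have z1 : ∑ q ∈ (O n).filter (fun q => q.1.1 = q.1.2), ((q.2.1 : ℤ) + q.2.2) ^ 2 = 0 := by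
    refine Finset.sum_eq_zero ?_
    rintro ⟨⟨a, b⟩, k, l⟩ h
    simp only [Finset.mem_filter, mem_O] at h
    obtain ⟨⟨⟨h1, h2, h3, h4, h5⟩, h6, h7⟩, h8⟩ := h
    exfalso
    subst h8
    rw [← mul_add] at h5
    have := (h6.add_odd h7).mul_left a
    rw [h5, Nat.even_iff] at this
    omega
  have z2 : ∑ q ∈ (O n).filter (fun q => q.2.1 = q.2.2), ((q.2.1 : ℤ) - q.2.2) ^ 2 = 0 := by
    refine Finset.sum_eq_zero ?_
    rintro q h
    rw [(Finset.mem_filter.mp h).2]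
    ring
  have z4 : ∑ q ∈ (E n).filter (fun q => q.2.1 = q.2.2), (q.2.2 : ℤ) ^ 2 = 0 := by
    refine Finset.sum_eq_zero ?_
    rintro ⟨⟨a, b⟩, k, l⟩ h
    simp only [Finset.mem_filter, mem_E] at h
    obtain ⟨⟨⟨h1, h2, h3, h4, h5⟩, h6, h7⟩, h8⟩ := h
    rw [Nat.odd_iff] at h6; rw [Nat.even_iff] at h7; omega
  have t1 := step1 n
  have t3 := step3 n
  have t5 := step5 n
  have t6 := step6 n N hn hN
  have t7 := sum_even_sq N
  have fin : 12 * ∑ q ∈ O n, ((q.2.1 : ℤ) * q.2.2)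
      = 2 * (2 * N * (N + 1) * (2 * N + 1)) := by
    rw [← t7, ← t6]
    linarith
  rw [fin, hN]; push_cast; ring

lemma exact_formula (n : ℕ) (hn : n.Prime) (h2 : 2 < n) :
    24 * ((∑ q ∈ ((Finset.Ioc 0 n ×ˢ Finset.Ioc 0 n) ×ˢ
              (Finset.Ioc 0 n ×ˢ Finset.Ioc 0 n)).filter
            (fun q : (ℕ × ℕ) × ℕ × ℕ =>
              Odd q.2.1 ∧ Odd q.2.2 ∧ Nat.Coprime q.1.1 q.1.2 ∧
                q.1.1 * q.2.1 + q.1.2 * q.2.2 = n ∧ q.2.1 < q.2.2),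
            q.2.1 * q.2.2 : ℕ) : ℤ) = (n : ℤ) ^ 3 - n - 12 * (n - 1) := by
  obtain ⟨N, hN⟩ := hn.odd_of_ne_two (by omega)
  have hset : ((Finset.Ioc 0 n ×ˢ Finset.Ioc 0 n) ×ˢ
              (Finset.Ioc 0 n ×ˢ Finset.Ioc 0 n)).filter
            (fun q : (ℕ × ℕ) × ℕ × ℕ =>
              Odd q.2.1 ∧ Odd q.2.2 ∧ Nat.Coprime q.1.1 q.1.2 ∧
                q.1.1 * q.2.1 + q.1.2 * q.2.2 = n ∧ q.2.1 < q.2.2)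
      = (O n).filter (fun q => q.2.1 < q.2.2) := by
    ext ⟨⟨a, b⟩, k, l⟩
    simp only [O, G, Finset.mem_filter, Finset.mem_product, Finset.mem_Ioc]
    constructor
    · tauto
    · rintro ⟨⟨⟨h, h5⟩, h6, h7⟩, h8⟩
      refine ⟨h, h6, h7, ?_, h5, h8⟩
      have hdvd : Nat.gcd a b ∣ n := by
        rw [← h5]
        exact dvd_add ((Nat.gcd_dvd_left a b).mul_right k) ((Nat.gcd_dvd_right a b).mul_right l)
      rcases (Nat.dvd_prime hn).mp hdvd with h9 | h9
      · exact h9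
      · exfalso
        have h10 : n ≤ a := by
          rw [← h9]; exact Nat.gcd_le_left b h.1.1.1
        have h11 : a ≤ a * k := Nat.le_mul_of_pos_right _ h.2.1.1
        have h12 : 0 < b * l := Nat.mul_pos h.1.2.1 h.2.2.1
        omega
  rw [hset]
  push_cast
  have e := split3 (O n) (fun q => q.2.1) (fun q => q.2.2) (fun q => (q.2.1 : ℤ) * q.2.2)
  have s := swap_sum n (fun q => q.2.1 < q.2.2) (fun q => q.2.2 < q.2.1)
    (fun q => (q.2.1 : ℤ) * q.2.2) (by simp) (by intros; ring)
  have d := diag n hn h2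
  have t := total n N hn hN
  linarith

end TwoCyl


/-- `S_ow(n) = ∑ kℓ` over quadruples `(a,b,k,ℓ)` of positive integers with
`k, ℓ` odd, `gcd(a,b) = 1`, `ak + bℓ = n` and `k < ℓ`, satisfies `S_ow(n)/n³ → 1/24`
as `n → ∞` along primes. -/
theorem two_cylinder_odd_widths_asymptotics :
    Tendsto
      (fun n : ℕ =>
        ((∑ q ∈ ((Finset.Ioc 0 n ×ˢ Finset.Ioc 0 n) ×ˢ
              (Finset.Ioc 0 n ×ˢ Finset.Ioc 0 n)).filter
            (fun q : (ℕ × ℕ) × ℕ × ℕ =>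
              Odd q.2.1 ∧ Odd q.2.2 ∧ Nat.Coprime q.1.1 q.1.2 ∧
                q.1.1 * q.2.1 + q.1.2 * q.2.2 = n ∧ q.2.1 < q.2.2),
            q.2.1 * q.2.2 : ℕ) : ℝ) / (n : ℝ) ^ 3)
      (atTop ⊓ Filter.principal {n : ℕ | n.Prime}) (nhds (1 / 24)) := by
  have hlim : Tendsto (fun n : ℕ => (1 / 24 : ℝ) - (13 / 24) * ((n : ℝ)⁻¹) ^ 2
      + (1 / 2) * ((n : ℝ)⁻¹) ^ 3) atTop (nhds (1 / 24)) := by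
    have h0 : Tendsto (fun n : ℕ => ((n : ℝ)⁻¹)) atTop (nhds 0) :=
      tendsto_inv_atTop_nhds_zero_nat
    have := (((h0.pow 2).const_mul (13 / 24 : ℝ)).const_sub (1 / 24 : ℝ)).add
      ((h0.pow 3).const_mul (1 / 2 : ℝ))
    simpa using this
  refine (hlim.mono_left inf_le_left).congr' ?_
  have hev : ∀ᶠ n : ℕ in atTop ⊓ Filter.principal {n : ℕ | n.Prime}, n.Prime ∧ 2 < n :=
    Filter.Eventually.and (mem_inf_of_right (mem_principal_self _))
      (mem_inf_of_left (eventually_gt_atTop 2))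
  filter_upwards [hev] with n hn
  have h := TwoCyl.exact_formula n hn.1 hn.2
  have h' := congrArg (fun z : ℤ => (z : ℝ)) h
  simp only [Int.cast_mul, Int.cast_sub, Int.cast_pow, Int.cast_natCast, Int.cast_ofNat,
    Int.cast_one] at h'
  have hpos : (n : ℝ) ≠ 0 := by
    have := hn.2
    positivity
  rw [eq_div_iff (pow_ne_zero 3 hpos)]
  have : ((1 / 24 : ℝ) - (13 / 24) * ((n : ℝ)⁻¹) ^ 2 + (1 / 2) * ((n : ℝ)⁻¹) ^ 3) * (n : ℝ) ^ 3
      = ((n : ℝ) ^ 3 - n - 12 * (n - 1)) / 24 := by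
    field_simp
    ring
  rw [this]
  linarith
end

section
/- Define S_eo(n) = ∑ kℓ, the sum over all quadruples (a,b,k,ℓ) of positive integers with ak + bℓ = n, k < ℓ, such that a and b are not both odd and k and ℓ are not both odd. Then S_eo(n)/n³ → 1/24 as n → ∞ along prime numbers n. -/
open Filter

namespace TwoCyl

/-- positive quadruples `((a,b),(k,l))` with `ak+bl=n` -/
def Q (n : ℕ) : Finset ((ℕ × ℕ) × ℕ × ℕ) :=
  ((Finset.Ioc 0 n ×ˢ Finset.Ioc 0 n) ×ˢ (Finset.Ioc 0 n ×ˢ Finset.Ioc 0 n)).filter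
    (fun q => q.1.1 * q.2.1 + q.1.2 * q.2.2 = n)

lemma mem_Q {n a b k l : ℕ} : ((a, b), (k, l)) ∈ Q n ↔
    0 < a ∧ 0 < b ∧ 0 < k ∧ 0 < l ∧ a * k + b * l = n := by
  simp only [Q, Finset.mem_filter, Finset.mem_product, Finset.mem_Ioc]
  constructor
  · rintro ⟨⟨⟨⟨h1, -⟩, h2, -⟩, ⟨h3, -⟩, h4, -⟩, h⟩
    exact ⟨h1, h2, h3, h4, h⟩
  · rintro ⟨h1, h2, h3, h4, h⟩
    have e1 := Nat.le_mul_of_pos_right a h3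
    have e2 := Nat.le_mul_of_pos_left k h1
    have e3 := Nat.le_mul_of_pos_right b h4
    have e4 := Nat.le_mul_of_pos_left l h2
    refine ⟨⟨⟨⟨h1, ?_⟩, h2, ?_⟩, ⟨h3, ?_⟩, h4, ?_⟩, h⟩ <;> omega

lemma sum_swap (n : ℕ) (g : ℕ → ℕ → ℕ → ℕ → ℤ) :
    ∑ q ∈ Q n, g q.1.1 q.1.2 q.2.1 q.2.2 = ∑ q ∈ Q n, g q.1.2 q.1.1 q.2.2 q.2.1 := by
  refine Finset.sum_nbij' (fun q => ((q.1.2, q.1.1), (q.2.2, q.2.1)))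
    (fun q => ((q.1.2, q.1.1), (q.2.2, q.2.1))) ?_ ?_ ?_ ?_ ?_
  all_goals rintro ⟨⟨a, b⟩, k, l⟩
  all_goals simp only [mem_Q, implies_true]
  all_goals rintro ⟨h1, h2, h3, h4, h⟩; refine ⟨h2, h1, h4, h3, ?_⟩; omega

lemma sum_transpose (n : ℕ) (g : ℕ → ℕ → ℕ → ℕ → ℤ) :
    ∑ q ∈ Q n, g q.1.1 q.1.2 q.2.1 q.2.2 = ∑ q ∈ Q n, g q.2.1 q.2.2 q.1.1 q.1.2 := by
  refine Finset.sum_nbij' (fun q => (q.2, q.1)) (fun q => (q.2, q.1)) ?_ ?_ ?_ ?_ ?_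
  all_goals rintro ⟨⟨a, b⟩, k, l⟩
  all_goals simp only [mem_Q, implies_true]
  all_goals
    rintro ⟨h1, h2, h3, h4, h⟩
    refine ⟨h3, h4, h1, h2, ?_⟩
    rw [← h]; ring

/-- the basic shear -/
lemma sum_shear (n : ℕ) (g : ℕ → ℕ → ℕ → ℕ → ℤ) :
    ∑ q ∈ (Q n).filter (fun q => q.2.1 < q.2.2), g (q.1.1 + q.1.2) q.1.2 q.2.1 (q.2.2 - q.2.1)
      = ∑ q ∈ (Q n).filter (fun q => q.1.2 < q.1.1), g q.1.1 q.1.2 q.2.1 q.2.2 := by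
  refine Finset.sum_nbij' (fun q => ((q.1.1 + q.1.2, q.1.2), (q.2.1, q.2.2 - q.2.1)))
    (fun q => ((q.1.1 - q.1.2, q.1.2), (q.2.1, q.2.1 + q.2.2))) ?_ ?_ ?_ ?_ ?_
  all_goals rintro ⟨⟨a, b⟩, k, l⟩
  all_goals simp only [Finset.mem_filter, mem_Q, implies_true]
  · rintro ⟨⟨h1, h2, h3, h4, h⟩, hl⟩
    obtain ⟨m, rfl⟩ := Nat.exists_eq_add_of_lt hl
    have : k + m + 1 - k = m + 1 := by omega
    rw [this]
    refine ⟨⟨by omega, h2, h3, by omega, ?_⟩, by omega⟩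
    rw [← h]; ring
  · rintro ⟨⟨h1, h2, h3, h4, h⟩, hl⟩
    obtain ⟨m, rfl⟩ := Nat.exists_eq_add_of_lt hl
    have : b + m + 1 - b = m + 1 := by omega
    rw [this]
    refine ⟨⟨by omega, h2, h3, by omega, ?_⟩, by omega⟩
    rw [← h]; ring
  · rintro ⟨⟨h1, h2, h3, h4, h⟩, hl⟩
    ext <;> simp <;> omega
  · rintro ⟨⟨h1, h2, h3, h4, h⟩, hl⟩
    ext <;> simp <;> omega

lemma sum_orbit (n : ℕ) (F : ℕ → ℤ) :
    ∑ q ∈ (Q n).filter (fun q => q.2.1 ≤ q.2.2), F q.1.1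
      = ∑ q ∈ (Q n).filter (fun q => q.1.2 ≤ q.1.1), F q.1.1 := by
  refine Finset.sum_nbij'
    (fun q => ((q.1.1, (q.1.2 - 1) % q.1.1 + 1), (q.2.1 + (q.1.2 - 1) / q.1.1 * q.2.2, q.2.2)))
    (fun q => ((q.1.1, q.1.2 + (q.2.1 - 1) / q.2.2 * q.1.1), ((q.2.1 - 1) % q.2.2 + 1, q.2.2)))
    ?_ ?_ ?_ ?_ ?_
  all_goals rintro ⟨⟨a, b⟩, k, l⟩
  all_goals simp only [Finset.mem_filter, mem_Q, implies_true]
  · rintro ⟨⟨h1, h2, h3, h4, h⟩, hl⟩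
    have e := Nat.mod_add_div (b - 1) a
    have e' := Nat.mod_lt (b - 1) h1
    refine ⟨⟨h1, by omega, by positivity, h4, ?_⟩, by omega⟩
    obtain ⟨c, rfl⟩ : ∃ c, b = c + 1 := ⟨b - 1, by omega⟩
    simp only [Nat.add_sub_cancel] at *
    rw [← h]
    nth_rewrite 3 [← e]
    ring
  · rintro ⟨⟨h1, h2, h3, h4, h⟩, hl⟩
    have e := Nat.mod_add_div (k - 1) l
    have e' := Nat.mod_lt (k - 1) h4
    refine ⟨⟨h1, by positivity, by omega, h4, ?_⟩, by omega⟩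
    obtain ⟨c, rfl⟩ : ∃ c, k = c + 1 := ⟨k - 1, by omega⟩
    simp only [Nat.add_sub_cancel] at *
    rw [← h]
    nth_rewrite 3 [← e]
    ring
  · rintro ⟨⟨h1, h2, h3, h4, h⟩, hl⟩
    have e := Nat.mod_add_div (b - 1) a
    have e1 : k + (b - 1) / a * l - 1 = (k - 1) + l * ((b - 1) / a) := by
      rw [mul_comm]; omega
    have e2 : (k - 1) < l := by omega
    rw [e1, Nat.add_mul_div_left _ _ h4, Nat.add_mul_mod_self_left, Nat.mod_eq_of_lt e2,
      Nat.div_eq_of_lt e2, zero_add, mul_comm ((b - 1) / a) a]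
    ext <;> simp <;> omega
  · rintro ⟨⟨h1, h2, h3, h4, h⟩, hl⟩
    have e := Nat.mod_add_div (k - 1) l
    have e1 : b + (k - 1) / l * a - 1 = (b - 1) + a * ((k - 1) / l) := by
      rw [mul_comm]; omega
    have e2 : (b - 1) < a := by omega
    rw [e1, Nat.add_mul_div_left _ _ h1, Nat.add_mul_mod_self_left, Nat.mod_eq_of_lt e2,
      Nat.div_eq_of_lt e2, zero_add, mul_comm ((k - 1) / l) l]
    ext <;> simp <;> omega

/-- the diagonal `k = l` for prime `n` -/
lemma sum_diag {p : ℕ} (hp : p.Prime) (g : ℕ → ℕ → ℕ → ℕ → ℤ) :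
    ∑ q ∈ (Q p).filter (fun q => q.2.1 = q.2.2), g q.1.1 q.1.2 q.2.1 q.2.2
      = ∑ a ∈ Finset.Ico 1 p, g a (p - a) 1 1 := by
  have key : ∀ a b k l : ℕ, (0 < a ∧ 0 < b ∧ 0 < k ∧ 0 < l ∧ a * k + b * l = p) → k = l →
      k = 1 ∧ l = 1 ∧ a + b = p := by
    rintro a b k l ⟨h1, h2, h3, h4, h⟩ rfl
    have h' : (a + b) * k = p := by rw [← h]; ring
    have := (Nat.dvd_prime hp).1 (Dvd.intro_left _ h')
    rcases this with rfl | rfl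
    · simpa using h'
    · have := Nat.eq_of_mul_eq_mul_right h3 (h'.trans (one_mul k).symm)
      omega
  refine Finset.sum_nbij' (fun q => q.1.1) (fun a => ((a, p - a), (1, 1))) ?_ ?_ ?_ ?_ ?_
  · rintro ⟨⟨a, b⟩, k, l⟩
    simp only [Finset.mem_filter, mem_Q, Finset.mem_Ico]
    rintro ⟨h, hl⟩
    have := key _ _ _ _ h hl
    omega
  · intro a
    simp only [Finset.mem_filter, mem_Q, Finset.mem_Ico]
    rintro ⟨h1, h2⟩
    refine ⟨⟨?_, ?_, ?_, ?_, ?_⟩, trivial⟩ <;> omega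
  · rintro ⟨⟨a, b⟩, k, l⟩
    simp only [Finset.mem_filter, mem_Q]
    rintro ⟨h, hl⟩
    have := key _ _ _ _ h hl
    ext <;> simp <;> omega
  · simp
  · rintro ⟨⟨a, b⟩, k, l⟩
    simp only [Finset.mem_filter, mem_Q]
    rintro ⟨h, hl⟩
    obtain ⟨rfl, rfl, h'⟩ := key _ _ _ _ h hl
    have : p - a = b := by omega
    rw [this]

lemma sum_diag' {p : ℕ} (hp : p.Prime) (F : ℕ → ℤ) :
    ∑ q ∈ (Q p).filter (fun q => q.1.1 = q.1.2), F q.1.1 = ((p : ℤ) - 1) * F 1 := by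
  have h := sum_diag hp (fun _ _ k _ => F k)
  rw [Finset.sum_filter] at h ⊢
  rw [sum_transpose p (fun a b k l => if a = b then F a else 0)]
  rw [h]
  have := hp.one_lt
  simp
  left
  push_cast [Nat.cast_sub this.le]
  ring

lemma sum_tri (n : ℕ) (x y : (ℕ × ℕ) × ℕ × ℕ → ℕ) (g : (ℕ × ℕ) × ℕ × ℕ → ℤ) :
    ∑ q ∈ Q n, g q = ∑ q ∈ (Q n).filter (fun q => x q < y q), g q
      + ∑ q ∈ (Q n).filter (fun q => y q < x q), g q
      + ∑ q ∈ (Q n).filter (fun q => x q = y q), g q := by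
  simp only [Finset.sum_filter, ← Finset.sum_add_distrib]
  refine Finset.sum_congr rfl fun q _ => ?_
  rcases lt_trichotomy (x q) (y q) with h | h | h
  · simp [h, h.not_gt, h.ne]
  · simp [h]
  · simp [h, h.not_gt, h.ne']

lemma sum_le_split (n : ℕ) (x y : (ℕ × ℕ) × ℕ × ℕ → ℕ) (g : (ℕ × ℕ) × ℕ × ℕ → ℤ) :
    ∑ q ∈ (Q n).filter (fun q => x q ≤ y q), g q
      = ∑ q ∈ (Q n).filter (fun q => x q < y q), g q
      + ∑ q ∈ (Q n).filter (fun q => x q = y q), g q := by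
  simp only [Finset.sum_filter, ← Finset.sum_add_distrib]
  refine Finset.sum_congr rfl fun q _ => ?_
  rcases lt_trichotomy (x q) (y q) with h | h | h
  · simp [h, h.le, h.ne]
  · simp [h]
  · simp [h.not_ge, h.not_gt, h.ne']

/-- Liouville's identity for primes. -/
lemma liouville {p : ℕ} (hp : p.Prime) (F : ℤ → ℤ) (hF : ∀ x, F (-x) = F x) (h0 : F 0 = 0) :
    ∑ q ∈ Q p, (F ((q.1.1 : ℤ) - q.1.2) - F ((q.1.1 : ℤ) + q.1.2))
      = 2 * (((p : ℤ) - 1) * F 1 - ∑ a ∈ Finset.Ico 1 p, F (a : ℤ)) - ((p : ℤ) - 1) * F p := by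
  rw [Finset.sum_sub_distrib]
  -- the minus part
  have m1 := sum_tri p (fun q => q.1.2) (fun q => q.1.1)
    (fun q => F ((q.1.1 : ℤ) - q.1.2))
  have m2 : ∑ q ∈ (Q p).filter (fun q => q.1.1 < q.1.2), F ((q.1.1 : ℤ) - q.1.2)
      = ∑ q ∈ (Q p).filter (fun q => q.1.2 < q.1.1), F ((q.1.1 : ℤ) - q.1.2) := by
    rw [Finset.sum_filter, Finset.sum_filter,
      sum_swap p (fun a b _ _ => if a < b then F ((a : ℤ) - b) else 0)]
    refine Finset.sum_congr rfl fun q _ => ?_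
    rw [← hF, neg_sub]
  have m3 : ∑ q ∈ (Q p).filter (fun q => q.1.2 = q.1.1), F ((q.1.1 : ℤ) - q.1.2) = 0 := by
    refine Finset.sum_eq_zero fun q hq => ?_
    rw [(Finset.mem_filter.1 hq).2, sub_self, h0]
  have m4 := sum_shear p (fun a b _ _ => F ((a : ℤ) - b))
  simp only [Nat.cast_add, add_sub_cancel_right] at m4
  -- the plus part
  have a1 := sum_tri p (fun q => q.2.1) (fun q => q.2.2)
    (fun q => F ((q.1.1 : ℤ) + q.1.2))
  have a2 : ∑ q ∈ (Q p).filter (fun q => q.2.2 < q.2.1), F ((q.1.1 : ℤ) + q.1.2)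
      = ∑ q ∈ (Q p).filter (fun q => q.2.1 < q.2.2), F ((q.1.1 : ℤ) + q.1.2) := by
    rw [Finset.sum_filter, Finset.sum_filter,
      sum_swap p (fun a b k l => if l < k then F ((a : ℤ) + b) else 0)]
    refine Finset.sum_congr rfl fun q _ => ?_
    rw [add_comm]
  have a3 := sum_diag hp (fun a b _ _ => F ((a : ℤ) + b))
  have a3' : ∑ a ∈ Finset.Ico 1 p, F ((a : ℤ) + (p - a : ℕ)) = ((p : ℤ) - 1) * F p := by
    rw [Finset.sum_congr rfl (g := fun _ => F p)]
    · have := hp.one_lt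
      simp
      left
      push_cast [Nat.cast_sub this.le]
      ring
    · intro a ha
      have := Finset.mem_Ico.1 ha
      congr 1
      omega
  have a4 := sum_shear p (fun a _ _ _ => F (a : ℤ))
  simp only [Nat.cast_add] at a4
  -- the orbit part
  have o1 := sum_orbit p (fun a => F (a : ℤ))
  have o2 := sum_le_split p (fun q => q.2.1) (fun q => q.2.2) (fun q => F (q.1.1 : ℤ))
  have o3 := sum_le_split p (fun q => q.1.2) (fun q => q.1.1) (fun q => F (q.1.1 : ℤ))
  have o4 := sum_diag hp (fun a _ _ _ => F (a : ℤ))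
  have o5 := sum_diag' hp (fun a => F (a : ℤ))
  simp only [eq_comm (a := Prod.fst (Prod.fst _))] at o5
  simp only [Nat.cast_one] at o5
  linarith

/-- the weight `1` on odd, `-2` on even integers -/
def w (x : ℤ) : ℤ := if Even x then -2 else 1

lemma sum_w {p : ℕ} (hp : p.Prime) (h2 : Odd p) :
    24 * ∑ q ∈ Q p, w ((q.1.1 : ℤ) - q.1.2) * ((q.1.1 : ℤ) * q.1.2)
      = 4 * (((p : ℤ) - 1) * (p + 1) * (p - 3)) := by
  have L := liouville hp (fun x => w x * x ^ 2) (by intro x; simp [w]) (by simp)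
  have e1 : ∑ q ∈ Q p, (w ((q.1.1 : ℤ) - q.1.2) * ((q.1.1 : ℤ) - q.1.2) ^ 2
      - w ((q.1.1 : ℤ) + q.1.2) * ((q.1.1 : ℤ) + q.1.2) ^ 2)
      = -4 * ∑ q ∈ Q p, w ((q.1.1 : ℤ) - q.1.2) * ((q.1.1 : ℤ) * q.1.2) := by
    rw [Finset.mul_sum]
    refine Finset.sum_congr rfl fun q _ => ?_
    have : w ((q.1.1 : ℤ) + q.1.2) = w ((q.1.1 : ℤ) - q.1.2) := by
      simp [w, Int.even_add, Int.even_sub]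
    rw [this]; ring
  have e2 : ∀ m : ℕ, 3 * ∑ a ∈ Finset.Ico 1 (2 * m + 1), w (a : ℤ) * (a : ℤ) ^ 2
      = -2 * (m * (m + 1) * (2 * m + 1)) - 6 * (m * (m + 1)) + 3 * (m : ℤ) := by
    intro m
    induction m with
    | zero => simp
    | succ m ih =>
      rw [show 2 * (m + 1) + 1 = 2 * m + 1 + 1 + 1 by ring,
        Finset.sum_Ico_succ_top (by omega), Finset.sum_Ico_succ_top (by omega),
        mul_add, mul_add, ih]
      have w1 : w ((2 * m + 1 : ℕ) : ℤ) = 1 := by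
        simp [w, Int.even_add]
      have w2 : w ((2 * m + 1 + 1 : ℕ) : ℤ) = -2 := by
        have : Even ((2 * m + 1 + 1 : ℕ) : ℤ) := ⟨m + 1, by push_cast; ring⟩
        rw [w, if_pos this]
      rw [w1, w2]
      push_cast
      ring
  obtain ⟨m, rfl⟩ := h2
  have e3 := e2 m
  have w1 : w ((2 * m + 1 : ℕ) : ℤ) = 1 := by simp [w, Int.even_add]
  have w2 : w 1 = 1 := by simp [w]
  rw [e1, w1, w2] at L
  push_cast at L ⊢
  linear_combination (-6) * L + 4 * e3

/-- moving a factor two from one height to the matching width -/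
lemma sum_double (n : ℕ) :
    ∑ q ∈ (Q n).filter (fun q => (Odd q.1.1 ∧ Odd q.2.1) ∧ Even q.1.2), (q.1.1 : ℤ) * q.1.2
      = 2 * ∑ q ∈ (Q n).filter (fun q => (Odd q.1.1 ∧ Odd q.2.1) ∧ Even q.2.2),
          (q.1.1 : ℤ) * q.1.2 := by
  rw [Finset.mul_sum]
  refine Finset.sum_nbij' (fun q => ((q.1.1, q.1.2 / 2), (q.2.1, 2 * q.2.2)))
    (fun q => ((q.1.1, 2 * q.1.2), (q.2.1, q.2.2 / 2))) ?_ ?_ ?_ ?_ ?_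
  all_goals rintro ⟨⟨a, b⟩, k, l⟩
  all_goals simp only [Finset.mem_filter, mem_Q]
  all_goals rintro ⟨⟨h1, h2, h3, h4, h⟩, ho, ⟨c, rfl⟩⟩
  all_goals rw [← two_mul] at *
  all_goals simp only [Nat.mul_div_cancel_left _ (two_pos)]
  · refine ⟨⟨h1, by omega, h3, by omega, ?_⟩, ho, even_two_mul _⟩
    rw [← h]; ring
  · refine ⟨⟨h1, by omega, h3, by omega, ?_⟩, ho, even_two_mul _⟩
    rw [← h]; ring
  · push_cast; ring

lemma sum_sym {n : ℕ} (hn : Odd n) (g : ℕ → ℕ → ℕ → ℕ → ℤ)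
    (hg : ∀ a b k l, g a b k l = g b a l k) :
    ∑ q ∈ Q n, g q.1.1 q.1.2 q.2.1 q.2.2
      = 2 * ∑ q ∈ Q n, if Odd q.1.1 ∧ Odd q.2.1 then g q.1.1 q.1.2 q.2.1 q.2.2 else 0 := by
  rw [two_mul]
  nth_rewrite 2 [sum_swap n (fun a b k l => if Odd a ∧ Odd k then g a b k l else 0)]
  rw [← Finset.sum_add_distrib]
  refine Finset.sum_congr rfl ?_
  rintro ⟨⟨a, b⟩, k, l⟩ hq
  obtain ⟨-, -, -, -, h⟩ := mem_Q.1 hq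
  rw [← h, Nat.odd_add, Nat.odd_mul, ← Nat.not_odd_iff_even, Nat.odd_mul] at hn
  simp only []
  rw [← hg a b k l]
  by_cases h1 : Odd a ∧ Odd k
  · simp [h1, hn.1 h1]
  · have : Odd b ∧ Odd l := by tauto
    simp [h1, this]

lemma sum_eo {n : ℕ} (hn : Odd n) :
    2 * ∑ q ∈ Q n, (if ¬(Odd q.1.1 ∧ Odd q.1.2) ∧ ¬(Odd q.2.1 ∧ Odd q.2.2)
        then (q.1.1 : ℤ) * q.1.2 else 0)
      = ∑ q ∈ Q n, w ((q.1.1 : ℤ) - q.1.2) * ((q.1.1 : ℤ) * q.1.2) := by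
  rw [sum_sym hn (fun a b k l => if ¬(Odd a ∧ Odd b) ∧ ¬(Odd k ∧ Odd l)
      then (a : ℤ) * b else 0) (by
        intro a b k l
        simp only [and_comm (a := Odd a), and_comm (a := Odd k), mul_comm (a : ℤ)]),
    sum_sym hn (fun a b k l => w ((a : ℤ) - b) * ((a : ℤ) * b)) (by
        intro a b k l
        have : w ((a : ℤ) - b) = w ((b : ℤ) - a) := by
          simp only [w, Int.even_sub, Int.even_coe_nat, iff_comm (a := Even a)]
        rw [this, mul_comm (a : ℤ)])]
  have D := sum_double n
  rw [Finset.sum_filter, Finset.sum_filter] at D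
  have key : 2 * ∑ q ∈ Q n, (if Odd q.1.1 ∧ Odd q.2.1 then
        (if ¬(Odd q.1.1 ∧ Odd q.1.2) ∧ ¬(Odd q.2.1 ∧ Odd q.2.2)
          then (q.1.1 : ℤ) * q.1.2 else 0) else 0)
      + ∑ q ∈ Q n, (if (Odd q.1.1 ∧ Odd q.2.1) ∧ Even q.1.2 then (q.1.1 : ℤ) * q.1.2 else 0)
      = ∑ q ∈ Q n, (if Odd q.1.1 ∧ Odd q.2.1 then
          w ((q.1.1 : ℤ) - q.1.2) * ((q.1.1 : ℤ) * q.1.2) else 0)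
      + 2 * ∑ q ∈ Q n,
        (if (Odd q.1.1 ∧ Odd q.2.1) ∧ Even q.2.2 then (q.1.1 : ℤ) * q.1.2 else 0) := by
    simp only [Finset.mul_sum, ← Finset.sum_add_distrib]
    refine Finset.sum_congr rfl ?_
    rintro ⟨⟨a, b⟩, k, l⟩ hq
    obtain ⟨-, -, -, -, h⟩ := mem_Q.1 hq
    rw [← h, Nat.odd_add, Nat.odd_mul, Nat.even_mul] at hn
    simp only []
    by_cases h1 : Odd a ∧ Odd k
    · have h2 := hn.1 h1
      have ha : ¬ Even a := Nat.not_even_iff_odd.2 h1.1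
      have hw : w ((a : ℤ) - b) = if Even b then 1 else -2 := by
        simp only [w, Int.even_sub, Int.even_coe_nat, ha, false_iff]
        by_cases hb : Even b <;> simp [hb]
      rw [hw]
      simp only [h1.1, h1.2, ← Nat.not_even_iff_odd (n := b), ← Nat.not_even_iff_odd (n := l)]
      by_cases hb : Even b <;> by_cases hl : Even l
      · simp [hb, hl]; try ring
      · simp [hb, hl]
      · simp [hb, hl]
      · tauto
    · simp [h1]
  linarith

lemma exact_count {p : ℕ} (hp : p.Prime) (h2 : Odd p) :
    24 * ((∑ q ∈ ((Finset.Ioc 0 p ×ˢ Finset.Ioc 0 p) ×ˢ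
              (Finset.Ioc 0 p ×ˢ Finset.Ioc 0 p)).filter
            (fun q : (ℕ × ℕ) × ℕ × ℕ =>
              q.1.1 * q.2.1 + q.1.2 * q.2.2 = p ∧ q.2.1 < q.2.2 ∧
                ¬(Odd q.1.1 ∧ Odd q.1.2) ∧ ¬(Odd q.2.1 ∧ Odd q.2.2)),
            q.2.1 * q.2.2 : ℕ) : ℤ) = ((p : ℤ) - 1) * (p + 1) * (p - 3) := by
  rw [← Finset.filter_filter]
  change 24 * ((∑ q ∈ (Q p).filter _, _ : ℕ) : ℤ) = _
  rw [Finset.sum_filter]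
  push_cast
  rw [sum_transpose p (fun a b k l => if k < l ∧ ¬(Odd a ∧ Odd b) ∧ ¬(Odd k ∧ Odd l)
    then (k : ℤ) * l else 0)]
  have E := sum_eo h2
  rw [← mul_right_inj' (show (24 : ℤ) ≠ 0 by norm_num), sum_w hp h2] at E
  have S : ∑ q ∈ Q p, (if ¬(Odd q.1.1 ∧ Odd q.1.2) ∧ ¬(Odd q.2.1 ∧ Odd q.2.2)
        then (q.1.1 : ℤ) * q.1.2 else 0)
      = 2 * ∑ q ∈ Q p, (if q.1.1 < q.1.2 ∧ ¬(Odd q.2.1 ∧ Odd q.2.2) ∧ ¬(Odd q.1.1 ∧ Odd q.1.2)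
        then (q.1.1 : ℤ) * q.1.2 else 0) := by
    rw [two_mul]
    nth_rewrite 2 [sum_swap p (fun a b k l => if a < b ∧ ¬(Odd k ∧ Odd l) ∧ ¬(Odd a ∧ Odd b)
        then (a : ℤ) * b else 0)]
    rw [← Finset.sum_add_distrib]
    refine Finset.sum_congr rfl ?_
    rintro ⟨⟨a, b⟩, k, l⟩ hq
    obtain ⟨-, -, -, -, h⟩ := mem_Q.1 hq
    rw [← h, Nat.odd_add, Nat.odd_mul, ← Nat.not_odd_iff_even, Nat.odd_mul] at h2
    simp only [and_comm (a := Odd b), and_comm (a := Odd l), mul_comm (b : ℤ)]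
    by_cases hc : ¬(Odd a ∧ Odd b) ∧ ¬(Odd k ∧ Odd l)
    · have hne : a ≠ b := by
        rintro rfl
        tauto
      rcases lt_or_gt_of_ne hne with hlt | hlt
      · simp only [hc, hlt, hlt.not_gt]; simp
      · simp only [hc, hlt, hlt.not_gt]; simp
    · rw [if_neg hc, if_neg (by tauto), if_neg (by tauto)]; rfl
  linarith

end TwoCyl

/-- `S_eo(n) = ∑ kℓ` over quadruples `(a,b,k,ℓ)` of positive integers with
`ak + bℓ = n`, `k < ℓ`, such that `a, b` are not both odd and `k, ℓ` are not both odd,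
satisfies `S_eo(n)/n³ → 1/24` as `n → ∞` along primes. -/
theorem two_cylinder_even_odd_asymptotics :
    Tendsto
      (fun n : ℕ =>
        ((∑ q ∈ ((Finset.Ioc 0 n ×ˢ Finset.Ioc 0 n) ×ˢ
              (Finset.Ioc 0 n ×ˢ Finset.Ioc 0 n)).filter
            (fun q : (ℕ × ℕ) × ℕ × ℕ =>
              q.1.1 * q.2.1 + q.1.2 * q.2.2 = n ∧ q.2.1 < q.2.2 ∧
                ¬(Odd q.1.1 ∧ Odd q.1.2) ∧ ¬(Odd q.2.1 ∧ Odd q.2.2)),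
            q.2.1 * q.2.2 : ℕ) : ℝ) / (n : ℝ) ^ 3)
      (atTop ⊓ Filter.principal {n : ℕ | n.Prime}) (nhds (1 / 24)) := by
  have hlim : Tendsto (fun n : ℕ => (1 / 24 : ℝ) * ((1 - (n : ℝ)⁻¹) * (1 + (n : ℝ)⁻¹)
      * (1 - 3 * (n : ℝ)⁻¹))) (atTop ⊓ Filter.principal {n : ℕ | n.Prime}) (nhds (1 / 24)) := by
    have h : Tendsto (fun n : ℕ => (n : ℝ)⁻¹) atTop (nhds 0) := tendsto_inv_atTop_nhds_zero_nat
    have := ((((h.const_sub 1).mul (h.const_add 1)).mul ((h.const_mul 3).const_sub 1)).const_mul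
      (1 / 24 : ℝ))
    norm_num at this
    refine (Tendsto.mono_left ?_ inf_le_left)
    norm_num
    exact this
  refine hlim.congr' ?_
  rw [Filter.EventuallyEq, Filter.eventually_inf_principal]
  filter_upwards [eventually_gt_atTop 2] with n hn hp
  have hodd : Odd n := hp.odd_of_ne_two (by omega)
  have h := TwoCyl.exact_count hp hodd
  have h' := congrArg (fun z : ℤ => (z : ℝ)) h
  simp only [Int.cast_mul, Int.cast_natCast, Int.cast_sub, Int.cast_add, Int.cast_one,
    Int.cast_ofNat] at h'
  have hn0 : (n : ℝ) ≠ 0 := by positivity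
  rw [eq_div_iff (pow_ne_zero 3 hn0)]
  rw [← mul_right_inj' (show (24 : ℝ) ≠ 0 by norm_num), h']
  field_simp
end
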